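/- Let n, m be positive integers, X an n×m real matrix with Xᵀ X invertible, F₀ ∈ ℝ^m, σ > 0, K_X > 0, K_Σ > 0. Suppose every eigenvalue of the symmetric matrix (Xᵀ X)/n is at least K_Σ, and let x ∈ ℝ^m satisfy ‖x‖₂ ≤ K_X. Let ε ∈ ℝ^n be a random vector with independent N(0, σ²) Gaussian coordinates and let F̂ = (Xᵀ X)^{-1} Xᵀ (X F₀ + ε) be the ordinary least squares estimate. Then E[ |⟨F̂ − F₀, x⟩| ] ≤ σ · K_X · √( m / (K_Σ · n) ). -/

import Mathlib

open MeasureTheory ProbabilityTheory Matrix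

open scoped MatrixOrder in
theorem Matrix.IsHermitian.mul_dotProduct_le_of_le_eigenvalues {ι : Type*} [Fintype ι]
    [DecidableEq ι] {A : Matrix ι ι ℝ} (hA : A.IsHermitian) {K : ℝ}
    (h : ∀ i, K ≤ hA.eigenvalues i) (y : ι → ℝ) : K * (y ⬝ᵥ y) ≤ y ⬝ᵥ A *ᵥ y := by
  have hle : algebraMap ℝ (Matrix ι ι ℝ) K ≤ A := by
    refine algebraMap_le_of_le_spectrum (fun r hr ↦ ?_) hA
    rw [hA.spectrum_real_eq_range_eigenvalues] at hr
    obtain ⟨i, rfl⟩ := hr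
    exact h i
  have hy := (Matrix.posSemidef_iff_dotProduct_mulVec.1 (Matrix.le_iff.1 hle)).2 y
  rw [Algebra.algebraMap_eq_smul_one, star_trivial, sub_mulVec, smul_mulVec, one_mulVec,
    dotProduct_sub, dotProduct_smul, smul_eq_mul] at hy
  linarith

theorem ProbabilityTheory.integral_abs_le_sqrt_integral_sq {Ω : Type*} [MeasurableSpace Ω]
    {μ : Measure Ω} [IsProbabilityMeasure μ] {Y : Ω → ℝ} (hY : MemLp Y 2 μ) :
    ∫ ω, |Y ω| ∂μ ≤ √(∫ ω, Y ω ^ 2 ∂μ) := by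
  apply Real.le_sqrt_of_sq_le
  have h := variance_nonneg |Y| μ
  rw [variance_eq_sub hY.abs] at h
  simpa using h

section GaussianVector

variable {ι : Type*} [Fintype ι] (v : NNReal) (w : ι → ℝ)

theorem memLp_const_mul_gaussianReal (c : ℝ) :
    MemLp (fun t ↦ c * t) 2 (gaussianReal 0 v) :=
  (memLp_id_gaussianReal' 2 (by simp)).const_mul c

theorem memLp_dotProduct_pi_gaussianReal :
    MemLp (fun ε : ι → ℝ ↦ w ⬝ᵥ ε) 2 (Measure.pi fun _ : ι ↦ gaussianReal 0 v) :=
  memLp_finsetSum _ fun i _ ↦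
    (memLp_const_mul_gaussianReal v (w i)).comp_measurePreserving (measurePreserving_eval _ i)

theorem integral_dotProduct_pi_gaussianReal :
    ∫ ε : ι → ℝ, w ⬝ᵥ ε ∂(Measure.pi fun _ : ι ↦ gaussianReal 0 v) = 0 := by
  simp only [dotProduct]
  rw [integral_finsetSum]
  · refine Finset.sum_eq_zero fun i _ ↦ ?_
    rw [integral_const_mul, integral_eval, integral_id_gaussianReal, mul_zero]
  · exact fun i _ ↦ ((memLp_const_mul_gaussianReal v (w i)).comp_measurePreserving
      (measurePreserving_eval _ i)).integrable (by norm_num)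

theorem integral_sq_dotProduct_pi_gaussianReal :
    ∫ ε : ι → ℝ, (w ⬝ᵥ ε) ^ 2 ∂(Measure.pi fun _ : ι ↦ gaussianReal 0 v) =
      v * (w ⬝ᵥ w) := by
  rw [← variance_of_integral_eq_zero
    (memLp_dotProduct_pi_gaussianReal v w).aestronglyMeasurable.aemeasurable
    (integral_dotProduct_pi_gaussianReal v w)]
  have h := variance_sum_pi (μ := fun _ : ι ↦ gaussianReal 0 v) (X := fun i t ↦ w i * t)
    fun i ↦ memLp_const_mul_gaussianReal v (w i)
  have hvar (i : ι) : Var[fun t ↦ w i * t; gaussianReal 0 v] = w i ^ 2 * v := by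
    rw [variance_const_mul (w i) (fun t ↦ t), variance_fun_id_gaussianReal]
  simp only [hvar] at h
  convert h using 1
  · congr 1
    ext ε
    simp [dotProduct]
  · rw [dotProduct, Finset.mul_sum]
    exact Finset.sum_congr rfl fun i _ ↦ by ring

end GaussianVector

theorem Matrix.dotProduct_mulVec_le_of_mul_dotProduct_le {ι : Type*} [Fintype ι]
    {A : Matrix ι ι ℝ} {c : ℝ} (hc : 0 < c)
    (h : ∀ y, c * (y ⬝ᵥ y) ≤ y ⬝ᵥ A *ᵥ y) (y : ι → ℝ) :
    y ⬝ᵥ A *ᵥ y ≤ (A *ᵥ y ⬝ᵥ A *ᵥ y) / c := by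
  have hcs : (y ⬝ᵥ A *ᵥ y) ^ 2 ≤ (y ⬝ᵥ y) * (A *ᵥ y ⬝ᵥ A *ᵥ y) := by
    simpa only [dotProduct, ← sq] using Finset.sum_mul_sq_le_sq_mul_sq Finset.univ y (A *ᵥ y)
  have hz : 0 ≤ A *ᵥ y ⬝ᵥ A *ᵥ y := by
    simpa using dotProduct_star_self_nonneg (A *ᵥ y)
  have hy := h y
  rw [le_div_iff₀ hc]
  by_contra! hlt
  have hpos : 0 < y ⬝ᵥ A *ᵥ y := pos_of_mul_pos_left (hz.trans_lt hlt) hc.le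
  nlinarith [mul_le_mul_of_nonneg_right hy hz, mul_lt_mul_of_pos_left hlt hpos]

theorem stmt10 (n m : ℕ) (hn : 0 < n) (hm : 0 < m)
    (X : Matrix (Fin n) (Fin m) ℝ) (hX : IsUnit (Xᵀ * X))
    (F₀ : Fin m → ℝ) (σ : NNReal) (hσ : 0 < σ) (K_X K : ℝ) (hKX : 0 < K_X) (hK : 0 < K)
    (hH : ((n : ℝ)⁻¹ • (Xᵀ * X)).IsHermitian)
    (heig : ∀ i, K ≤ hH.eigenvalues i)
    (x : Fin m → ℝ) (hx : ‖(EuclideanSpace.equiv (Fin m) ℝ).symm x‖ ≤ K_X)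
    (Fhat : (Fin n → ℝ) → Fin m → ℝ)
    (hFhat : ∀ ε, Fhat ε = (Xᵀ * X)⁻¹.mulVec (Xᵀ.mulVec (X.mulVec F₀ + ε))) :
    ∫ ε : Fin n → ℝ,
        |∑ j, (Fhat ε j - F₀ j) * x j|
          ∂(Measure.pi fun _ : Fin n => gaussianReal 0 (σ ^ 2)) ≤
      (σ : ℝ) * K_X * Real.sqrt (m / (K * n)) := by
  have hn' : (0 : ℝ) < n := by exact_mod_cast hn
  have hdet : IsUnit (Xᵀ * X).det := (Matrix.isUnit_iff_isUnit_det _).1 hX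
  set y := (Xᵀ * X)⁻¹ *ᵥ x with hy
  have hAy : (Xᵀ * X) *ᵥ y = x := by
    rw [hy, mulVec_mulVec, mul_nonsing_inv _ hdet, one_mulVec]
  have hsymm : ((Xᵀ * X)⁻¹)ᵀ = (Xᵀ * X)⁻¹ := by
    rw [transpose_nonsing_inv, transpose_mul, transpose_transpose]
  have herr (ε : Fin n → ℝ) : ∑ j, (Fhat ε j - F₀ j) * x j = X *ᵥ y ⬝ᵥ ε := by
    have hF : Fhat ε - F₀ = (Xᵀ * X)⁻¹ *ᵥ (Xᵀ *ᵥ ε) := by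
      rw [hFhat, mulVec_add, mulVec_add, mulVec_mulVec F₀, mulVec_mulVec F₀, nonsing_inv_mul _ hdet,
        one_mulVec, add_sub_cancel_left]
    change (Fhat ε - F₀) ⬝ᵥ x = _
    rw [hF, dotProduct_comm, dotProduct_mulVec, ← mulVec_transpose, hsymm, ← hy,
      dotProduct_mulVec, vecMul_transpose]
  have hw : X *ᵥ y ⬝ᵥ X *ᵥ y = y ⬝ᵥ (Xᵀ * X) *ᵥ y := by
    rw [← mulVec_mulVec, dotProduct_mulVec y, vecMul_transpose]
  have hray (z : Fin m → ℝ) : K * n * (z ⬝ᵥ z) ≤ z ⬝ᵥ (Xᵀ * X) *ᵥ z := by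
    have h := hH.mul_dotProduct_le_of_le_eigenvalues heig z
    rw [smul_mulVec, dotProduct_smul, smul_eq_mul, inv_mul_eq_div, le_div_iff₀ hn'] at h
    linarith
  have hxx : x ⬝ᵥ x ≤ K_X ^ 2 := by
    have h := pow_le_pow_left₀ (norm_nonneg _) hx 2
    rw [EuclideanSpace.norm_sq_eq] at h
    simpa [dotProduct, ← sq] using h
  have hbound : X *ᵥ y ⬝ᵥ X *ᵥ y ≤ K_X ^ 2 * (m / (K * n)) := by
    have h := dotProduct_mulVec_le_of_mul_dotProduct_le (by positivity) hray y
    rw [hAy] at h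
    rw [hw, hAy]
    calc y ⬝ᵥ x ≤ x ⬝ᵥ x / (K * n) := h
      _ ≤ K_X ^ 2 * m / (K * n) := by
        have hm' : (1 : ℝ) ≤ m := by exact_mod_cast hm
        gcongr
        nlinarith [sq_nonneg K_X]
      _ = K_X ^ 2 * (m / (K * n)) := by ring
  simp only [herr]
  refine (integral_abs_le_sqrt_integral_sq (memLp_dotProduct_pi_gaussianReal _ _)).trans ?_
  rw [integral_sq_dotProduct_pi_gaussianReal]
  apply Real.sqrt_le_iff.2 ⟨by positivity, ?_⟩
  rw [mul_pow, mul_pow, Real.sq_sqrt (by positivity), mul_assoc, NNReal.coe_pow]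
  gcongr
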